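/- For every generalized MMT M with n = max over states q of |χ^M(q)|, there exists an MMT N that is symbolically equivalent to M, is complete whenever M is complete, and has at most n! · |Q^M| states. -/

import Mathlib

open scoped Classical

/-- Actions of an MMT: inputs or timeouts of timers. -/
inductive Act (I X : Type) where
  | inp : I → Act I X
  | to  : X → Act I X

/-- Symbolic actions: inputs, or timeouts annotated with (constant, index). -/
inductive SymAct (I : Type) where
  | inp : I → SymAct I
  | to  : ℕ → ℕ → SymAct I

/-- Labels of the timed transition system, abstracting timer names on timeouts. -/
inductive TLabel (I O : Type) where
  | delay : ℝ → TLabel I O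
  | inp   : I → O → TLabel I O
  | tout  : O → TLabel I O

/-- A Mealy machine with timers (MMT). -/
structure MMT (I O X Q : Type) where
  q0 : Q
  chi : Q → Set X
  δ : Q → Act I X → Option (Q × O × Option (X × ℕ))

namespace MMT

variable {I O X Q X₁ Q₁ X₂ Q₂ X₃ Q₃ : Type}

/-- A transition occurring along a run. -/
structure Trans (I O X Q : Type) where
  src : Q
  act : Act I X
  out : O
  upd : Option (X × ℕ)
  dst : Q

/-- The list of transitions of the run of `M` from `p` reading `w`, if defined. -/
def trace? (M : MMT I O X Q) : Q → List (Act I X) → Option (List (Trans I O X Q))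
  | _, [] => some []
  | p, a :: rest =>
    (M.δ p a).bind fun t =>
      (trace? M t.1 rest).map fun l => ⟨p, a, t.2.1, t.2.2, t.1⟩ :: l

/-- The state reached from `p` after reading `w`, if the run is defined. -/
def stateAfter (M : MMT I O X Q) (p : Q) (w : List (Act I X)) : Option Q :=
  w.foldlM (fun q a => (M.δ q a).map fun t => t.1) p

/-- State of the symbolic-word computation: current state, index of next transition,
cause map, symbolic word so far, output word so far. -/
structure SymState (I O X Q : Type) where
  st : Q
  idx : ℕ
  cm : X → Option (ℕ × ℕ)
  sw : List (SymAct I)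
  ow : List O

noncomputable def symStep (M : MMT I O X Q) (σ : SymState I O X Q) (a : Act I X) :
    Option (SymState I O X Q) :=
  (M.δ σ.st a).bind fun t =>
    (match a with
      | Act.inp i => some (SymAct.inp i)
      | Act.to x => (σ.cm x).map fun (p : ℕ × ℕ) => SymAct.to p.1 p.2).map fun sa =>
      { st := t.1
        idx := σ.idx + 1
        cm := fun y => match t.2.2 with
          | some (x, c) => if y = x then some (c, σ.idx) else σ.cm y
          | none => σ.cm y
        sw := σ.sw ++ [sa]
        ow := σ.ow ++ [t.2.1] }

noncomputable def symRun (M : MMT I O X Q) (w : List (Act I X)) : Option (SymState I O X Q) :=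
  w.foldlM M.symStep ⟨M.q0, 1, fun _ => none, [], []⟩

/-- The symbolic input word of the run of `M` from the initial state reading `w`. -/
noncomputable def symWord (M : MMT I O X Q) (w : List (Act I X)) : Option (List (SymAct I)) :=
  (M.symRun w).map SymState.sw

/-- The output word of the run of `M` from the initial state reading `w`. -/
noncomputable def outWord (M : MMT I O X Q) (w : List (Act I X)) : Option (List O) :=
  (M.symRun w).map SymState.ow

/-- The cause map after reading `w` from the initial state. -/
noncomputable def causeAfter (M : MMT I O X Q) (w : List (Act I X)) :
    Option (X → Option (ℕ × ℕ)) :=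
  (M.symRun w).map SymState.cm

/-- cause(π, x) for the run π reading `w` from the initial state. -/
noncomputable def causeOf (M : MMT I O X Q) (w : List (Act I X)) (x : X) : Option (ℕ × ℕ) :=
  (M.causeAfter w).bind fun cm => cm x

/-! ### Timed semantics -/

/-- The initial configuration. -/
def initC (M : MMT I O X Q) : Q × (X → ℝ) := (M.q0, fun _ => 0)

/-- Delay transition between configurations. -/
def DelayStep (M : MMT I O X Q) (C : Q × (X → ℝ)) (d : ℝ) (C' : Q × (X → ℝ)) : Prop :=
  0 ≤ d ∧ (∀ x ∈ M.chi C.1, d ≤ C.2 x) ∧ C'.1 = C.1 ∧ C'.2 = fun x => C.2 x - d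

/-- Discrete transition between configurations, reading action `a` with output `o`. -/
def DStep (M : MMT I O X Q) (C : Q × (X → ℝ)) (a : Act I X) (o : O)
    (C' : Q × (X → ℝ)) : Prop :=
  ∃ u, M.δ C.1 a = some (C'.1, o, u) ∧
    (∀ x, a = Act.to x → x ∈ M.chi C.1 ∧ C.2 x = 0) ∧
    C'.2 = match u with
      | some (x, c) => Function.update C.2 x (c : ℝ)
      | none => C.2

/-- Steps labelled by `TLabel`s, abstracting the name of the timer that times out. -/
def Step (M : MMT I O X Q) (C : Q × (X → ℝ)) : TLabel I O → Q × (X → ℝ) → Prop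
  | TLabel.delay d => fun C' => M.DelayStep C d C'
  | TLabel.inp i o => fun C' => M.DStep C (Act.inp i) o C'
  | TLabel.tout o  => fun C' => ∃ x, M.DStep C (Act.to x) o C'

/-- A timed bisimulation between two MMTs. -/
def IsTimedBisim (M : MMT I O X₁ Q₁) (N : MMT I O X₂ Q₂)
    (R : Q₁ × (X₁ → ℝ) → Q₂ × (X₂ → ℝ) → Prop) : Prop :=
  R M.initC N.initC ∧
  (∀ C D, R C D → ∀ l C', M.Step C l C' → ∃ D', N.Step D l D' ∧ R C' D') ∧
  (∀ C D, R C D → ∀ l D', N.Step D l D' → ∃ C', M.Step C l C' ∧ R C' D')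

/-- Timed-bisimulation equivalence. -/
def TBisim (M : MMT I O X₁ Q₁) (N : MMT I O X₂ Q₂) : Prop :=
  ∃ R, IsTimedBisim M N R

inductive MultiStep (M : MMT I O X Q) : Q × (X → ℝ) → List (TLabel I O) → Q × (X → ℝ) → Prop
  | nil (C) : MultiStep M C [] C
  | cons {C l C' w C''} : M.Step C l C' → MultiStep M C' w C'' → MultiStep M C (l :: w) C''

/-- The set of timed traces of `M` (sequences of labels executable from the initial
configuration). -/
def Traces (M : MMT I O X Q) : Set (List (TLabel I O)) :=
  {w | ∃ C, MultiStep M M.initC w C}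

/-- Timed runs keeping the concrete actions: alternating delays and discrete steps. -/
inductive TRun (M : MMT I O X Q) : Q × (X → ℝ) → List (ℝ × Act I X) → Q × (X → ℝ) → Prop
  | nil (C) : TRun M C [] C
  | cons {C d C₁ a o C₂ rest C'} :
      M.DelayStep C d C₁ → M.DStep C₁ a o C₂ → TRun M C₂ rest C' →
      TRun M C ((d, a) :: rest) C'

/-- A word of actions is feasible if it is the untimed projection of a timed run from
the initial configuration. -/
def Feasible (M : MMT I O X Q) (w : List (Act I X)) : Prop :=
  ∃ ds : List ℝ, ∃ C, ds.length = w.length ∧ TRun M M.initC (ds.zip w) C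

/-- A configuration is reachable if some timed run from the initial configuration,
possibly followed by a delay, ends in it. -/
def Reachable (M : MMT I O X Q) (C : Q × (X → ℝ)) : Prop :=
  ∃ ts C₀ d, TRun M M.initC ts C₀ ∧ M.DelayStep C₀ d C

/-- The timers enabled in a state: active timers that reach value 0 in some reachable
configuration. -/
def enabled (M : MMT I O X Q) (q : Q) : Set X :=
  {x | x ∈ M.chi q ∧ ∃ κ, M.Reachable (q, κ) ∧ κ x = 0}

/-- Completeness: all inputs and all timeouts of enabled timers are defined. -/
def Complete (M : MMT I O X Q) : Prop :=
  ∀ q : Q, (∀ i : I, (M.δ q (Act.inp i)).isSome) ∧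
    (∀ x ∈ M.enabled q, (M.δ q (Act.to x)).isSome)

/-- All updates set timers to positive integer values. -/
def PosUpdates (M : MMT I O X Q) : Prop :=
  ∀ q a t, M.δ q a = some t → ∀ x c, t.2.2 = some (x, c) → 1 ≤ c

/-- s-learnable: complete and every (untimed) run from the initial state is feasible. -/
def SLearnable (M : MMT I O X Q) : Prop :=
  M.Complete ∧ ∀ w, (M.stateAfter M.q0 w).isSome → M.Feasible w

/-- The symbolic input language of `M`. -/
def SymLang (M : MMT I O X Q) : Set (List (SymAct I)) :=
  {s | ∃ w, M.Feasible w ∧ M.symWord w = some s}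

/-- Pairs (symbolic input word, output word) of feasible runs of `M`. -/
def SymLangO (M : MMT I O X Q) : Set (List (SymAct I) × List O) :=
  {p | ∃ w, M.Feasible w ∧ M.symWord w = some p.1 ∧ M.outWord w = some p.2}

/-- Symbolic equivalence of two MMTs. -/
def SymEquiv (M : MMT I O X₁ Q₁) (N : MMT I O X₂ Q₂) : Prop :=
  M.SymLang = N.SymLang ∧ ∀ s os, (s, os) ∈ M.SymLangO ↔ (s, os) ∈ N.SymLangO

/-- Race-free timed runs: positive delays, a timer is 0 after a delay iff it times out
next, and no timer is 0 after the final delay `dfin`. -/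
inductive RFRun (M : MMT I O X Q) :
    Q × (X → ℝ) → List (ℝ × Act I X) → ℝ → Q × (X → ℝ) → Prop
  | nil {C d C'} : 0 < d → M.DelayStep C d C' →
      (∀ x ∈ M.chi C'.1, C'.2 x ≠ 0) → RFRun M C [] d C'
  | cons {C d C₁ a o C₂ rest dfin C'} : 0 < d → M.DelayStep C d C₁ →
      (∀ x ∈ M.chi C₁.1, (C₁.2 x = 0 ↔ a = Act.to x)) →
      M.DStep C₁ a o C₂ → RFRun M C₂ rest dfin C' →
      RFRun M C ((d, a) :: rest) dfin C'

/-- Race-avoiding: every feasible run is the untimed projection of a race-free timed run. -/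
def RaceAvoiding (M : MMT I O X Q) : Prop :=
  ∀ w, M.Feasible w →
    ∃ ds : List ℝ, ∃ dfin C, ds.length = w.length ∧ RFRun M M.initC (ds.zip w) dfin C

/-- Starting times of the inputs occurring in a timed run. -/
def inputTimes : ℝ → List (ℝ × Act I X) → List ℝ
  | _, [] => []
  | t, (d, Act.inp _) :: rest => (t + d) :: inputTimes (t + d) rest
  | t, (d, Act.to _) :: rest => inputTimes (t + d) rest

/-- A timed run is transparent if the fractional parts of the starting times of its
inputs are pairwise distinct. -/
def Transparent (ts : List (ℝ × Act I X)) : Prop :=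
  (inputTimes 0 ts).Pairwise fun a b => Int.fract a ≠ Int.fract b

/-- The timed input word of a timed run (with final delay), merging delays around
timeouts. -/
def tiw : List (ℝ × Act I X) → ℝ → List (ℝ × I) × ℝ
  | [], dfin => ([], dfin)
  | (d, Act.inp i) :: rest, dfin =>
    let r := tiw rest dfin
    ((d, i) :: r.1, r.2)
  | (d, Act.to _) :: rest, dfin =>
    match tiw rest dfin with
    | ([], f) => ([], d + f)
    | ((d', i) :: l, f) => ((d + d', i) :: l, f)

/-- Timer `x`, active at the end of the feasible run reading `w`, is live after it:
it expires in some feasible extension before being stopped or restarted. -/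
def Live (M : MMT I O X Q) (w : List (Act I X)) (x : X) : Prop :=
  ∃ w', M.Feasible (w ++ w' ++ [Act.to x]) ∧
    M.causeOf (w ++ w') x = M.causeOf w x ∧
    (∀ k ≤ w'.length, ∃ q, M.stateAfter M.q0 (w ++ w'.take k) = some q ∧ x ∈ M.chi q)

/-! ### Functional simulations and observation trees -/

/-- Renaming of actions along a timer renaming. -/
def gAct (g : X₁ → X₂) : Act I X₁ → Act I X₂
  | Act.inp i => Act.inp i
  | Act.to x => Act.to (g x)

/-- Functional simulation from an observation tree `T` into an MMT `M`. -/
structure FunSim (T : MMT I O X₁ Q₁) (M : MMT I O X₂ Q₂) (f : Q₁ → Q₂) (g : X₁ → X₂) :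
    Prop where
  fs0 : f T.q0 = M.q0
  fs1 : ∀ q x, x ∈ T.chi q → g x ∈ M.chi (f q)
  fs2 : ∀ q x y, x ∈ T.chi q → y ∈ T.chi q → x ≠ y → g x ≠ g y
  fs3 : ∀ q a t, T.δ q a = some t → ∃ u, M.δ (f q) (gAct g a) = some (f t.1, t.2.1, u)
  fs4 : ∀ w q x, T.stateAfter T.q0 w = some q → (T.δ q (Act.to x)).isSome →
      T.causeOf w x = M.causeOf (w.map (gAct g)) (g x)

/-- In an observation tree, a timer is enabled in `q` iff its timeout transition exists. -/
def enabledOT (T : MMT I O X Q) (q : Q) : Set X :=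
  {x | (T.δ q (Act.to x)).isSome}

/-- The run from `p` reading `w` is `x`-spanning. -/
def SpanningFrom (M : MMT I O X Q) (p : Q) (w : List (Act I X)) (x : X) : Prop :=
  ∃ tr, M.trace? p w = some tr ∧ 1 ≤ tr.length ∧
    (∃ t c, tr.head? = some t ∧ t.upd = some (x, c)) ∧
    (∃ t, tr.getLast? = some t ∧ t.act = Act.to x) ∧
    (∀ j t, 1 ≤ j → j + 1 < tr.length → tr[j]? = some t → ∀ c, t.upd ≠ some (x, c)) ∧
    (∀ j t, 1 ≤ j → j < tr.length → tr[j]? = some t → x ∈ M.chi t.src)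

/-- Observation tree structure: `xt q` is the own timer of state `q`. -/
structure IsObsTree (T : MMT I O X Q) (xt : Q → X) : Prop where
  root_chi : T.chi T.q0 = ∅
  tree : ∀ q : Q, ∃! w, T.stateAfter T.q0 w = some q
  fresh : ∀ q i t x c, T.δ q (Act.inp i) = some t → t.2.2 = some (x, c) → x = xt t.1
  to_self : ∀ q y t x c, T.δ q (Act.to y) = some t → t.2.2 = some (x, c) → x = y
  feas : ∀ w, (T.stateAfter T.q0 w).isSome → T.Feasible w
  active_iff : ∀ q x, x ∈ T.chi q ↔
      ∃ p w j, T.SpanningFrom p w x ∧ 1 ≤ j ∧ j < w.length ∧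
        T.stateAfter p (w.take j) = some q
  enabled_iff : ∀ q x, x ∈ T.enabled q ↔ (T.δ q (Act.to x)).isSome

/-! ### Matchings, copy runs and apartness -/

/-- `m` is a matching from the active timers of `p` to those of `p'`. -/
def IsMatching (T : MMT I O X Q) (p p' : Q) (m : X → Option X) : Prop :=
  (∀ x y, m x = some y → x ∈ T.chi p ∧ y ∈ T.chi p') ∧
  (∀ x₁ x₂ y, m x₁ = some y → m x₂ = some y → x₁ = x₂)

/-- Maximal matching: total or surjective on the active timers. -/
def MaxMatching (T : MMT I O X Q) (p p' : Q) (m : X → Option X) : Prop :=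
  IsMatching T p p' m ∧
    ((∀ x ∈ T.chi p, (m x).isSome) ∨ (∀ y ∈ T.chi p', ∃ x, m x = some y))

/-- Copy of the run reading `w` from `p` onto a run from `p'`, translating actions via
the matching and the fresh timers of visited states; returns the copied word and the
extended matching `m↑`. -/
noncomputable def copyAux (T : MMT I O X Q) (xt : Q → X) :
    (X → Option X) → Q → Q → List (Act I X) → Option (List (Act I X) × (X → Option X))
  | m, _, _, [] => some ([], m)
  | m, p, p', a :: rest =>
    (match a with
      | Act.inp i => some (Act.inp i : Act I X)
      | Act.to x => (m x).map Act.to).bind fun a' =>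
      (T.δ p a).bind fun t =>
        (T.δ p' a').bind fun t' =>
          (copyAux T xt (fun z => if z = xt t.1 then some (xt t'.1) else m z) t.1 t'.1
              rest).map fun (r : List (Act I X) × (X → Option X)) => (a' :: r.1, r.2)

/-- `w` witnesses that `p` and `p'` are `m`-apart (structural or behavioral). -/
def Witness (T : MMT I O X Q) (xt : Q → X) (E : Set Q) (m : X → Option X)
    (p p' : Q) (w : List (Act I X)) : Prop :=
  ∃ w' mf qn qn',
    copyAux T xt m p p' w = some (w', mf) ∧
    T.stateAfter p w = some qn ∧ T.stateAfter p' w' = some qn' ∧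
    ((∃ x y q, mf x = some y ∧ x ∈ T.chi q ∧ y ∈ T.chi q) ∨
      (∃ tr tr' t t', T.trace? p w = some tr ∧ T.trace? p' w' = some tr' ∧
        tr.getLast? = some t ∧ tr'.getLast? = some t' ∧
        (t.out ≠ t'.out ∨
          ∃ x c x' c', t.upd = some (x, c) ∧ t'.upd = some (x', c') ∧ c ≠ c')) ∨
      (qn ∈ E ∧ qn' ∈ E ∧ (T.enabledOT qn).ncard ≠ (T.enabledOT qn').ncard) ∨
      (qn ∈ E ∧ qn' ∈ E ∧
        ∃ x y, mf x = some y ∧ ¬(x ∈ T.enabledOT qn ↔ y ∈ T.enabledOT qn')))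

/-- `w` witnesses a behavioral apartness of `p` and `p'` under `m`. -/
def WitnessBeh (T : MMT I O X Q) (xt : Q → X) (E : Set Q) (m : X → Option X)
    (p p' : Q) (w : List (Act I X)) : Prop :=
  ∃ w' mf qn qn',
    copyAux T xt m p p' w = some (w', mf) ∧
    T.stateAfter p w = some qn ∧ T.stateAfter p' w' = some qn' ∧
    ((∃ tr tr' t t', T.trace? p w = some tr ∧ T.trace? p' w' = some tr' ∧
        tr.getLast? = some t ∧ tr'.getLast? = some t' ∧
        (t.out ≠ t'.out ∨
          ∃ x c x' c', t.upd = some (x, c) ∧ t'.upd = some (x', c') ∧ c ≠ c')) ∨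
      (qn ∈ E ∧ qn' ∈ E ∧ (T.enabledOT qn).ncard ≠ (T.enabledOT qn').ncard) ∨
      (qn ∈ E ∧ qn' ∈ E ∧
        ∃ x y, mf x = some y ∧ ¬(x ∈ T.enabledOT qn ↔ y ∈ T.enabledOT qn')))

/-- `p` and `p'` are `m`-apart. -/
def Apart (T : MMT I O X Q) (xt : Q → X) (E : Set Q) (m : X → Option X)
    (p p' : Q) : Prop :=
  ∃ w, Witness T xt E m p p' w

/-- `E` is a set of explored states: the tree-enabled timers of each `q ∈ E` are in
one-to-one correspondence (via `g`) with the enabled timers of `f q`. -/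
def ExploredOK (T : MMT I O X₁ Q₁) (M : MMT I O X₂ Q₂) (f : Q₁ → Q₂) (g : X₁ → X₂)
    (E : Set Q₁) : Prop :=
  ∀ q ∈ E, Set.BijOn g (T.enabledOT q) (M.enabled (f q))

/-- The composed matching `μ ∘ m⁻¹`. -/
noncomputable def invComp (μ m : X → Option X) : X → Option X :=
  fun y => if h : ∃ x, m x = some y then μ h.choose else none

/-- Result of replaying a run. -/
inductive ReplayResult where
  | DONE | APART | ACTIVE

/-- Replaying the run reading `w` from `p'` against the (static) observation tree. -/
noncomputable def replayRes (T : MMT I O X Q) (xt : Q → X) (E : Set Q)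
    (m : X → Option X) (p p' : Q) (w : List (Act I X)) : ReplayResult :=
  if Apart T xt E m p p' then ReplayResult.APART
  else if (copyAux T xt m p p' w).isSome then ReplayResult.DONE
  else ReplayResult.ACTIVE

/-! ### Transparency of timed traces over `TLabel` -/

def inputTimesL : ℝ → List (TLabel I O) → List ℝ
  | _, [] => []
  | t, TLabel.delay d :: rest => inputTimesL (t + d) rest
  | t, TLabel.inp _ _ :: rest => t :: inputTimesL t rest
  | t, TLabel.tout _ :: rest => inputTimesL t rest

/-- A timed trace is transparent if the fractional parts of the starting times of its
inputs are pairwise distinct. -/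
def TransparentTr (w : List (TLabel I O)) : Prop :=
  (inputTimesL 0 w).Pairwise fun a b => Int.fract a ≠ Int.fract b

end MMT

/-- A generalized Mealy machine with timers: transitions carry update functions that
may rename timers (value `Sum.inl y` renames `y`, value `Sum.inr c` starts with
constant `c`). -/
structure GMMT (I O X Q : Type) where
  q0 : Q
  chi : Q → Set X
  δ : Q → Act I X → Option (Q × O × (X → Option (X ⊕ ℕ)))

namespace GMMT

variable {I O X Q : Type}

/-- Well-formedness of a gMMT. -/
def WF (G : GMMT I O X Q) : Prop :=
  G.chi G.q0 = ∅ ∧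
  ∀ q a t, G.δ q a = some t →
    (∀ x, (t.2.2 x).isSome ↔ x ∈ G.chi t.1) ∧
    (∀ x y z, t.2.2 x = some z → t.2.2 y = some z → x = y) ∧
    (∀ x y, t.2.2 x = some (Sum.inl y) → y ∈ G.chi q) ∧
    (∀ x c, t.2.2 x = some (Sum.inr c) → 1 ≤ c) ∧
    (∀ x y c c', t.2.2 x = some (Sum.inr c) → t.2.2 y = some (Sum.inr c') → x = y) ∧
    (∀ x, a = Act.to x → x ∈ G.chi q ∧ ∀ y, t.2.2 y ≠ some (Sum.inl x))

def initC (G : GMMT I O X Q) : Q × (X → ℝ) := (G.q0, fun _ => 0)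

def DelayStep (G : GMMT I O X Q) (C : Q × (X → ℝ)) (d : ℝ) (C' : Q × (X → ℝ)) : Prop :=
  0 ≤ d ∧ (∀ x ∈ G.chi C.1, d ≤ C.2 x) ∧ C'.1 = C.1 ∧ C'.2 = fun x => C.2 x - d

def DStep (G : GMMT I O X Q) (C : Q × (X → ℝ)) (a : Act I X) (o : O)
    (C' : Q × (X → ℝ)) : Prop :=
  ∃ u, G.δ C.1 a = some (C'.1, o, u) ∧
    (∀ x, a = Act.to x → x ∈ G.chi C.1 ∧ C.2 x = 0) ∧
    (∀ y c, u y = some (Sum.inr c) → C'.2 y = (c : ℝ)) ∧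
    (∀ y z, u y = some (Sum.inl z) → C'.2 y = C.2 z)

inductive TRun (G : GMMT I O X Q) : Q × (X → ℝ) → List (ℝ × Act I X) → Q × (X → ℝ) → Prop
  | nil (C) : TRun G C [] C
  | cons {C d C₁ a o C₂ rest C'} :
      G.DelayStep C d C₁ → G.DStep C₁ a o C₂ → TRun G C₂ rest C' →
      TRun G C ((d, a) :: rest) C'

def Feasible (G : GMMT I O X Q) (w : List (Act I X)) : Prop :=
  ∃ ds : List ℝ, ∃ C, ds.length = w.length ∧ TRun G G.initC (ds.zip w) C

def Reachable (G : GMMT I O X Q) (C : Q × (X → ℝ)) : Prop :=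
  ∃ ts C₀ d, TRun G G.initC ts C₀ ∧ G.DelayStep C₀ d C

def enabled (G : GMMT I O X Q) (q : Q) : Set X :=
  {x | x ∈ G.chi q ∧ ∃ κ, G.Reachable (q, κ) ∧ κ x = 0}

def Complete (G : GMMT I O X Q) : Prop :=
  ∀ q : Q, (∀ i : I, (G.δ q (Act.inp i)).isSome) ∧
    (∀ x ∈ G.enabled q, (G.δ q (Act.to x)).isSome)

structure SymState (I O X Q : Type) where
  st : Q
  idx : ℕ
  cm : X → Option (ℕ × ℕ)
  sw : List (SymAct I)
  ow : List O

noncomputable def symStep (G : GMMT I O X Q) (σ : SymState I O X Q) (a : Act I X) :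
    Option (SymState I O X Q) :=
  (G.δ σ.st a).bind fun t =>
    (match a with
      | Act.inp i => some (SymAct.inp i)
      | Act.to x => (σ.cm x).map fun (p : ℕ × ℕ) => SymAct.to p.1 p.2).map fun sa =>
      { st := t.1
        idx := σ.idx + 1
        cm := fun y => match t.2.2 y with
          | some (Sum.inr c) => some (c, σ.idx)
          | some (Sum.inl z) => σ.cm z
          | none => none
        sw := σ.sw ++ [sa]
        ow := σ.ow ++ [t.2.1] }

noncomputable def symRun (G : GMMT I O X Q) (w : List (Act I X)) :
    Option (SymState I O X Q) :=
  w.foldlM G.symStep ⟨G.q0, 1, fun _ => none, [], []⟩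

noncomputable def symWord (G : GMMT I O X Q) (w : List (Act I X)) :
    Option (List (SymAct I)) :=
  (G.symRun w).map SymState.sw

noncomputable def outWord (G : GMMT I O X Q) (w : List (Act I X)) : Option (List O) :=
  (G.symRun w).map SymState.ow

def SymLang (G : GMMT I O X Q) : Set (List (SymAct I)) :=
  {s | ∃ w, G.Feasible w ∧ G.symWord w = some s}

def SymLangO (G : GMMT I O X Q) : Set (List (SymAct I) × List O) :=
  {p | ∃ w, G.Feasible w ∧ G.symWord w = some p.1 ∧ G.outWord w = some p.2}

/-- Symbolic equivalence between a gMMT and an MMT. -/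
def SymEquivM {X' Q' : Type} (G : GMMT I O X Q) (N : MMT I O X' Q') : Prop :=
  G.SymLang = N.SymLang ∧ ∀ s os, (s, os) ∈ G.SymLangO ↔ (s, os) ∈ N.SymLangO

end GMMT

/-- `b` (over the timers in `s`) becomes `a` when timers are renamed along `μ`. -/
inductive ActRen {I X Y : Type} {s : Set X} (μ : s ↪ Y) : Act I X → Act I Y → Prop
  | inp (i : I) : ActRen μ (Act.inp i) (Act.inp i)
  | timeout (x : s) : ActRen μ (Act.to x) (Act.to (μ x))

theorem ActRen.left_unique {I X Y : Type} {s : Set X} {μ : s ↪ Y} {b b' : Act I X}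
    {a : Act I Y} (h : ActRen μ b a) (h' : ActRen μ b' a) : b = b' := by
  cases h with
  | inp i => cases h'; rfl
  | timeout x =>
    generalize hy : (Act.to (μ x) : Act I Y) = a' at h'
    cases h' with
    | inp i => cases hy
    | timeout x' =>
      have hx : μ x = μ x' := by injection hy
      rw [μ.injective hx]

/-- Two valuations agree along the renaming `μ`. -/
def AgreeAlong {X Y α : Type} {s : Set X} (μ : s ↪ Y) (f : X → α) (g : Y → α) : Prop :=
  ∀ x : s, g (μ x) = f x

/-- The update `up` of a single timer, together with the change of renaming from `μ` to `μ'`,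
realizes the generalized update `u`. -/
structure Realizes {X Y : Type} {s s' : Set X} (μ : s ↪ Y) (u : X → Option (X ⊕ ℕ))
    (μ' : s' ↪ Y) (up : Option (Y × ℕ)) : Prop where
  renamed : ∀ (y : s') (z : s), u y = some (Sum.inl z.1) → μ' y = μ z
  not_started : ∀ (y : s') (z : s), u y = some (Sum.inl z.1) → ∀ c, up ≠ some (μ' y, c)
  started : ∀ (y : s') (c : ℕ), u y = some (Sum.inr c) → up = some (μ' y, c)

/-- The effect on a valuation of starting a single timer. -/
noncomputable def startTimer {Y α : Type} (up : Option (Y × ℕ)) (v : ℕ → α) (g : Y → α) : Y → α :=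
  match up with
  | some (x, c) => Function.update g x (v c)
  | none => g

theorem Realizes.startTimer_started {X Y α : Type} {s s' : Set X} {μ : s ↪ Y}
    {u : X → Option (X ⊕ ℕ)} {μ' : s' ↪ Y} {up : Option (Y × ℕ)} (h : Realizes μ u μ' up)
    (v : ℕ → α) (g : Y → α) {y : s'} {c : ℕ} (hy : u y = some (Sum.inr c)) :
    startTimer up v g (μ' y) = v c := by
  rw [h.started y c hy]
  simp [startTimer]

theorem Realizes.startTimer_renamed {X Y α : Type} {s s' : Set X} {μ : s ↪ Y}
    {u : X → Option (X ⊕ ℕ)} {μ' : s' ↪ Y} {up : Option (Y × ℕ)} (h : Realizes μ u μ' up)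
    (v : ℕ → α) {f : X → α} {g : Y → α} (hfg : AgreeAlong μ f g) {y : s'} {z : s}
    (hy : u y = some (Sum.inl z.1)) : startTimer up v g (μ' y) = f z := by
  have hne := h.not_started y z hy
  rw [← hfg z, ← h.renamed y z hy]
  match up with
  | none => rfl
  | some (x, c) =>
    have hx : μ' y ≠ x := fun hx => hne c (by rw [hx])
    simp [startTimer, Function.update_of_ne hx]

namespace GMMT

variable {I O X Q : Type}

theorem WF.cases_update {G : GMMT I O X Q} (hwf : G.WF) {q : Q} {b : Act I X}
    {t : Q × O × (X → Option (X ⊕ ℕ))} (ht : G.δ q b = some t) (y : G.chi t.1) :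
    (∃ z : G.chi q, t.2.2 y = some (Sum.inl z.1)) ∨ ∃ c, t.2.2 y = some (Sum.inr c) := by
  obtain ⟨hdom, -, hsrc, -⟩ := hwf.2 q b t ht
  obtain ⟨r, hr⟩ := Option.isSome_iff_exists.1 ((hdom y).2 y.2)
  rcases r with z | c
  · exact Or.inl ⟨⟨z, hsrc _ _ hr⟩, hr⟩
  · exact Or.inr ⟨c, hr⟩

theorem WF.exists_realizes [Finite X] {G : GMMT I O X Q} (hwf : G.WF) {n : ℕ}
    (hn : ∀ q : Q, (G.chi q).ncard ≤ n) {q : Q} {b : Act I X}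
    {t : Q × O × (X → Option (X ⊕ ℕ))} (ht : G.δ q b = some t) (μ : G.chi q ↪ Fin n) :
    ∃ (μ' : G.chi t.1 ↪ Fin n) (up : Option (Fin n × ℕ)), Realizes μ t.2.2 μ' up := by
  obtain ⟨-, hinj, -, -, huniq, -⟩ := hwf.2 q b t ht
  have key : ∀ y : G.chi t.1, ∃ j : Fin n,
      (∀ z : G.chi q, t.2.2 y = some (Sum.inl z.1) → j = μ z) ∧
      ∀ c, t.2.2 y = some (Sum.inr c) →
        ∀ (y' : G.chi t.1) (z : G.chi q), t.2.2 y' = some (Sum.inl z.1) → j ≠ μ z := by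
    intro y
    rcases hwf.cases_update ht y with ⟨z, hz⟩ | ⟨c, hc⟩
    · refine ⟨μ z, fun z' hz' => ?_, fun c hc => ?_⟩
      · rw [hz] at hz'
        rw [Subtype.ext (Sum.inl.inj (Option.some.inj hz'))]
      · rw [hz] at hc
        cases hc
    · by_contra! hcon
      have hall : ∀ j : Fin n, ∃ (y' : G.chi t.1) (z : G.chi q),
          t.2.2 y' = some (Sum.inl z.1) ∧ j = μ z := by
        intro j
        obtain ⟨-, -, y', z, h⟩ := hcon j (fun z hz => by rw [hc] at hz; cases hz)
        exact ⟨y', z, h⟩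
      choose F Z hF hZ using hall
      have hFinj : Function.Injective F := by
        intro j j' hjj
        have h := hF j
        rw [hjj, hF j'] at h
        rw [hZ j, hZ j', Subtype.ext (Sum.inl.inj (Option.some.inj h))]
      have hbij := hFinj.bijective_of_nat_card_le (by simpa using hn t.1)
      obtain ⟨j, hj⟩ := hbij.2 y
      have h := hF j
      rw [hj, hc] at h
      cases h
  choose F hF₁ hF₂ using key
  have hFinj : Function.Injective F := by
    intro y y' hyy
    rcases hwf.cases_update ht y with ⟨z, hz⟩ | ⟨c, hc⟩ <;>
      rcases hwf.cases_update ht y' with ⟨z', hz'⟩ | ⟨c', hc'⟩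
    · have h : z = z' := μ.injective (by rw [← hF₁ y z hz, ← hF₁ y' z' hz', hyy])
      subst h
      exact Subtype.ext (hinj _ _ _ hz hz')
    · exact absurd (hyy.symm.trans (hF₁ y z hz)) (hF₂ y' c' hc' y z hz)
    · exact absurd (hyy.trans (hF₁ y' z' hz')) (hF₂ y c hc y' z' hz')
    · exact Subtype.ext (huniq _ _ _ _ hc hc')
  by_cases hst : ∃ (y : G.chi t.1) (c : ℕ), t.2.2 y = some (Sum.inr c)
  · obtain ⟨y₀, c₀, h₀⟩ := hst
    refine ⟨⟨F, hFinj⟩, some (F y₀, c₀), fun y => hF₁ y, fun y z hz c h => ?_, fun y c hc => ?_⟩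
    · have h' : y₀ = y := hFinj (congrArg Prod.fst (Option.some.inj h))
      rw [← h', h₀] at hz
      cases hz
    · obtain rfl : y₀ = y := Subtype.ext (huniq _ _ _ _ h₀ hc)
      rw [h₀] at hc
      cases hc
      rfl
  · exact ⟨⟨F, hFinj⟩, none, fun y => hF₁ y, fun _ _ _ _ h => (nomatch h),
      fun y c hc => absurd ⟨y, c, hc⟩ hst⟩

/-- States of `G` together with a naming of the active timers. -/
abbrev Named (G : GMMT I O X Q) (n : ℕ) : Type := Σ q : Q, (G.chi q ↪ Fin n)

/-- `N` performs the transitions of `G` on named states, renaming timers on the fly. -/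
structure IsRenaming (G : GMMT I O X Q) {n : ℕ} (N : MMT I O (Fin n) (G.Named n)) : Prop where
  q0 : N.q0.1 = G.q0
  chi : ∀ s, N.chi s = Set.range s.2
  forward : ∀ s b a t, ActRen s.2 b a → G.δ s.1 b = some t →
    ∃ (μ' : G.chi t.1 ↪ Fin n) (up : Option (Fin n × ℕ)),
      N.δ s a = some (⟨t.1, μ'⟩, t.2.1, up) ∧ Realizes s.2 t.2.2 μ' up
  backward : ∀ s a r, N.δ s a = some r →
    ∃ b t, ActRen s.2 b a ∧ G.δ s.1 b = some t

theorem WF.exists_isRenaming [Finite X] {G : GMMT I O X Q} (hwf : G.WF) {n : ℕ}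
    (hn : ∀ q : Q, (G.chi q).ncard ≤ n) :
    ∃ N : MMT I O (Fin n) (G.Named n), G.IsRenaming N := by
  have hemp : IsEmpty (G.chi G.q0) := by
    rw [hwf.1]
    infer_instance
  have key : ∀ (s : G.Named n) (a : Act I (Fin n)),
      ∃ r : Option (G.Named n × O × Option (Fin n × ℕ)),
        (∀ b t, ActRen s.2 b a → G.δ s.1 b = some t →
          ∃ (μ' : G.chi t.1 ↪ Fin n) (up : Option (Fin n × ℕ)),
            r = some (⟨t.1, μ'⟩, t.2.1, up) ∧ Realizes s.2 t.2.2 μ' up) ∧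
        (r.isSome → ∃ b t, ActRen s.2 b a ∧ G.δ s.1 b = some t) := by
    intro s a
    by_cases h : ∃ b t, ActRen s.2 b a ∧ G.δ s.1 b = some t
    · obtain ⟨b, t, hb, ht⟩ := h
      obtain ⟨μ', up, hr⟩ := hwf.exists_realizes hn ht s.2
      refine ⟨some (⟨t.1, μ'⟩, t.2.1, up), fun b' t' hb' ht' => ?_, fun _ => ⟨b, t, hb, ht⟩⟩
      obtain rfl := hb.left_unique hb'
      obtain rfl := Option.some.inj (ht.symm.trans ht')
      exact ⟨μ', up, rfl, hr⟩
    · exact ⟨none, fun b t hb ht => absurd ⟨b, t, hb, ht⟩ h, fun h' => by simp at h'⟩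
  choose d hd₁ hd₂ using key
  exact ⟨⟨⟨G.q0, Function.Embedding.ofIsEmpty⟩, fun s => Set.range s.2, d⟩, rfl, fun _ => rfl,
    fun s b a => hd₁ s a b, fun s a r hr => hd₂ s a (by rw [show d s a = some r from hr]; rfl)⟩

/-- Corresponding words of actions read by `G` and by its renaming `N`. -/
inductive WordRen (G : GMMT I O X Q) {n : ℕ} (N : MMT I O (Fin n) (G.Named n)) :
    G.Named n → List (Act I X) → List (Act I (Fin n)) → Prop
  | nil (s) : WordRen G N s [] []
  | cons {s b a t μ' up w w'} : ActRen s.2 b a → G.δ s.1 b = some t →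
      N.δ s a = some (⟨t.1, μ'⟩, t.2.1, up) → Realizes s.2 t.2.2 μ' up →
      WordRen G N ⟨t.1, μ'⟩ w w' → WordRen G N s (b :: w) (a :: w')

/-- A configuration of `G` and one of its renaming agree on state and active timers. -/
def ConfigRen (G : GMMT I O X Q) {n : ℕ} (C : Q × (X → ℝ))
    (D : G.Named n × (Fin n → ℝ)) : Prop :=
  C.1 = D.1.1 ∧ AgreeAlong D.1.2 C.2 D.2

variable {G : GMMT I O X Q} {n : ℕ} {N : MMT I O (Fin n) (G.Named n)}

theorem IsRenaming.configRen_initC (hN : G.IsRenaming N) :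
    G.ConfigRen G.initC N.initC := by
  exact ⟨hN.q0.symm, fun _ => rfl⟩

theorem IsRenaming.delay_forward (hN : G.IsRenaming N) {C C' : Q × (X → ℝ)}
    {D : G.Named n × (Fin n → ℝ)} (hCD : G.ConfigRen C D) {d : ℝ}
    (h : G.DelayStep C d C') : ∃ D', N.DelayStep D d D' ∧ D'.1 = D.1 ∧ G.ConfigRen C' D' := by
  obtain ⟨q, κ⟩ := C
  obtain ⟨⟨q', μ⟩, κ'⟩ := D
  obtain ⟨rfl, hag⟩ := hCD
  obtain ⟨h0, hle, hst, hval⟩ := h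
  refine ⟨(⟨q, μ⟩, fun x => κ' x - d), ⟨h0, fun x hx => ?_, rfl, rfl⟩, rfl, hst, fun x => ?_⟩
  · rw [hN.chi] at hx
    obtain ⟨y, rfl⟩ := hx
    exact (hle y y.2).trans_eq (hag y).symm
  · simp only [hval]
    exact congrArg (· - d) (hag x)

theorem IsRenaming.delay_backward (hN : G.IsRenaming N) {C : Q × (X → ℝ)}
    {D D' : G.Named n × (Fin n → ℝ)} (hCD : G.ConfigRen C D) {d : ℝ}
    (h : N.DelayStep D d D') : D'.1 = D.1 ∧ ∃ C', G.DelayStep C d C' ∧ G.ConfigRen C' D' := by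
  obtain ⟨q, κ⟩ := C
  obtain ⟨⟨q', μ⟩, κ'⟩ := D
  obtain ⟨D₁, D₂⟩ := D'
  obtain ⟨rfl, hag⟩ := hCD
  obtain ⟨h0, hle, hst, hval⟩ := h
  obtain rfl : D₁ = _ := hst
  refine ⟨rfl, (q, fun x => κ x - d), ⟨h0, fun x hx => ?_, rfl, rfl⟩, rfl, fun x => ?_⟩
  · exact (hle (μ ⟨x, hx⟩) (by rw [hN.chi]; exact ⟨_, rfl⟩)).trans_eq (hag ⟨x, hx⟩)
  · obtain rfl : D₂ = _ := hval
    exact congrArg (· - d) (hag x)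

theorem IsRenaming.discrete_forward (hwf : G.WF) (hN : G.IsRenaming N) {C C' : Q × (X → ℝ)}
    {D : G.Named n × (Fin n → ℝ)} (hCD : G.ConfigRen C D) {b : Act I X} {o : O}
    (h : G.DStep C b o C') :
    ∃ a D', N.DStep D a o D' ∧ G.ConfigRen C' D' ∧
      ∀ w w', WordRen G N D'.1 w w' → WordRen G N D.1 (b :: w) (a :: w') := by
  obtain ⟨q, κ⟩ := C
  obtain ⟨⟨q', μ⟩, κ'⟩ := D
  obtain ⟨rfl, hag⟩ := hCD
  obtain ⟨u, hδ, hto, hstart, hren⟩ := h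
  obtain ⟨a, ha⟩ : ∃ a, ActRen μ b a := by
    rcases b with i | x
    · exact ⟨_, .inp i⟩
    · exact ⟨_, .timeout ⟨x, (hto x rfl).1⟩⟩
  obtain ⟨μ', up, hNδ, hr⟩ := hN.forward ⟨q, μ⟩ b a _ ha hδ
  refine ⟨a, (⟨C'.1, μ'⟩, startTimer up (fun c => (c : ℝ)) κ'), ⟨up, hNδ, ?_, rfl⟩,
    ⟨rfl, fun y => ?_⟩, fun w w' hw => .cons ha hδ hNδ hr hw⟩
  · rintro x rfl
    generalize hx : (Act.to x : Act I (Fin n)) = a at ha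
    cases ha with
    | inp i => cases hx
    | timeout y =>
      obtain rfl : x = μ y := by injection hx
      refine ⟨by rw [hN.chi]; exact ⟨y, rfl⟩, (hag y).trans (hto y rfl).2⟩
  · rcases hwf.cases_update hδ y with ⟨z, hz⟩ | ⟨c, hc⟩
    · exact (hr.startTimer_renamed _ hag hz).trans (hren _ _ hz).symm
    · exact (hr.startTimer_started _ _ hc).trans (hstart _ _ hc).symm

theorem IsRenaming.discrete_backward (hwf : G.WF) (hN : G.IsRenaming N) {C : Q × (X → ℝ)}
    {D D' : G.Named n × (Fin n → ℝ)} (hCD : G.ConfigRen C D) {a : Act I (Fin n)} {o : O}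
    (h : N.DStep D a o D') :
    ∃ b C', G.DStep C b o C' ∧ G.ConfigRen C' D' ∧
      ∀ w w', WordRen G N D'.1 w w' → WordRen G N D.1 (b :: w) (a :: w') := by
  obtain ⟨q, κ⟩ := C
  obtain ⟨⟨q', μ⟩, κ'⟩ := D
  obtain ⟨rfl, hag⟩ := hCD
  obtain ⟨D₁, D₂⟩ := D'
  obtain ⟨up', hNδ, hto, hval⟩ := h
  obtain ⟨b, t, hb, ht⟩ := hN.backward _ _ _ hNδ
  obtain ⟨μ', up, hNδ', hr⟩ := hN.forward _ _ _ _ hb ht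
  have heq := Option.some.inj (hNδ.symm.trans hNδ')
  simp only [Prod.mk.injEq] at heq
  obtain ⟨rfl, rfl, rfl⟩ := heq
  obtain rfl : D₂ = startTimer up' (fun c => (c : ℝ)) κ' := hval
  have hmem : ∀ {y r}, t.2.2 y = some r → y ∈ G.chi t.1 := fun h =>
    ((hwf.2 _ _ _ ht).1 _).1 (by rw [h]; rfl)
  have hext : ∀ y : G.chi t.1, (fun y => if hy : y ∈ G.chi t.1 then
      startTimer up' (fun c => (c : ℝ)) κ' (μ' ⟨y, hy⟩) else 0) y.1 =
      startTimer up' (fun c => (c : ℝ)) κ' (μ' y) := fun y => by simp [y.2]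
  refine ⟨b, (t.1, fun y => if hy : y ∈ G.chi t.1 then
      startTimer up' (fun c => (c : ℝ)) κ' (μ' ⟨y, hy⟩) else 0),
    ⟨t.2.2, ht, ?_, fun y c hc => ?_, fun y z hz => ?_⟩, ⟨rfl, fun y => (hext y).symm⟩,
    fun w w' hw => .cons hb ht hNδ hr hw⟩
  · rintro x rfl
    generalize hx : (Act.to x : Act I X) = b at hb
    cases hb with
    | inp i => cases hx
    | timeout y =>
      obtain rfl : x = y := by injection hx
      exact ⟨y.2, (hag y).symm.trans (hto _ rfl).2⟩
  · exact (hext ⟨y, hmem hc⟩).trans (hr.startTimer_started _ _ hc)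
  · have hz' := (hwf.2 _ _ _ ht).2.2.1 _ _ hz
    exact (hext ⟨y, hmem hz⟩).trans (hr.startTimer_renamed (z := ⟨z, hz'⟩) _ hag hz)

theorem IsRenaming.run_forward (hwf : G.WF) (hN : G.IsRenaming N) {C C' : Q × (X → ℝ)}
    {ts : List (ℝ × Act I X)} (h : G.TRun C ts C') :
    ∀ D : G.Named n × (Fin n → ℝ), G.ConfigRen C D →
      ∃ ts' D', N.TRun D ts' D' ∧ WordRen G N D.1 (ts.map Prod.snd) (ts'.map Prod.snd) := by
  induction h with
  | nil C => exact fun D _ => ⟨[], D, .nil D, .nil _⟩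
  | cons hd hs _ ih =>
    intro D hCD
    obtain ⟨D₁, hD₁, hst, hCD₁⟩ := hN.delay_forward hCD hd
    obtain ⟨a, D₂, hD₂, hCD₂, hw⟩ := hN.discrete_forward hwf hCD₁ hs
    obtain ⟨ts', D', hrun, hword⟩ := ih D₂ hCD₂
    exact ⟨_, D', .cons hD₁ hD₂ hrun, hst ▸ hw _ _ hword⟩

theorem IsRenaming.run_backward (hwf : G.WF) (hN : G.IsRenaming N)
    {D D' : G.Named n × (Fin n → ℝ)} {ts' : List (ℝ × Act I (Fin n))} (h : N.TRun D ts' D') :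
    ∀ C : Q × (X → ℝ), G.ConfigRen C D →
      ∃ ts C', G.TRun C ts C' ∧ G.ConfigRen C' D' ∧
        WordRen G N D.1 (ts.map Prod.snd) (ts'.map Prod.snd) := by
  induction h with
  | nil D => exact fun C hCD => ⟨[], C, .nil C, hCD, .nil _⟩
  | cons hd hs _ ih =>
    intro C hCD
    obtain ⟨hst, C₁, hC₁, hCD₁⟩ := hN.delay_backward hCD hd
    obtain ⟨b, C₂, hC₂, hCD₂, hw⟩ := hN.discrete_backward hwf hCD₁ hs
    obtain ⟨ts, C', hrun, hCD', hword⟩ := ih C₂ hCD₂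
    exact ⟨_, C', .cons hC₁ hC₂ hrun, hCD', hst ▸ hw _ _ hword⟩

theorem feasible_iff {w : List (Act I X)} :
    G.Feasible w ↔ ∃ ts C, G.TRun G.initC ts C ∧ ts.map Prod.snd = w := by
  constructor
  · rintro ⟨ds, C, hlen, hrun⟩
    exact ⟨_, C, hrun, List.map_snd_zip hlen.ge⟩
  · rintro ⟨ts, C, hrun, rfl⟩
    refine ⟨ts.map Prod.fst, C, by simp, ?_⟩
    rwa [← List.zip_of_prod (xs := ts) rfl rfl]

theorem _root_.MMT.feasible_iff {M : MMT I O X Q} {w : List (Act I X)} :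
    M.Feasible w ↔ ∃ ts C, M.TRun M.initC ts C ∧ ts.map Prod.snd = w := by
  constructor
  · rintro ⟨ds, C, hlen, hrun⟩
    exact ⟨_, C, hrun, List.map_snd_zip hlen.ge⟩
  · rintro ⟨ts, C, hrun, rfl⟩
    refine ⟨ts.map Prod.fst, C, by simp, ?_⟩
    rwa [← List.zip_of_prod (xs := ts) rfl rfl]

theorem WF.agreeAlong_cause (hwf : G.WF) {q : Q} {b : Act I X}
    {t : Q × O × (X → Option (X ⊕ ℕ))} (ht : G.δ q b = some t) {μ : G.chi q ↪ Fin n}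
    {μ' : G.chi t.1 ↪ Fin n} {up : Option (Fin n × ℕ)} (hr : Realizes μ t.2.2 μ' up) (idx : ℕ)
    {cm : X → Option (ℕ × ℕ)} {cm' : Fin n → Option (ℕ × ℕ)} (hag : AgreeAlong μ cm cm') :
    AgreeAlong μ'
      (fun y => match t.2.2 y with
        | some (Sum.inr c) => some (c, idx)
        | some (Sum.inl z) => cm z
        | none => none)
      (fun y => match (generalizing := false) up with
        | some (x, c) => if y = x then some (c, idx) else cm' y
        | none => cm' y) := by
  intro y
  have hstart : (fun y => match (generalizing := false) up with
      | some (x, c) => if y = x then some (c, idx) else cm' y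
      | none => cm' y) = startTimer up (fun c => some (c, idx)) cm' := by
    funext y
    match up with
    | none => rfl
    | some (x, c) => simp [startTimer, Function.update_apply]
  rw [hstart]
  rcases hwf.cases_update ht y with ⟨z, hz⟩ | ⟨c, hc⟩
  · simp only [hr.startTimer_renamed _ hag hz, hz]
  · simp only [hr.startTimer_started _ _ hc, hc]

theorem WordRen.foldlM_symStep (hwf : G.WF) {s : G.Named n} {w : List (Act I X)}
    {w' : List (Act I (Fin n))} (h : WordRen G N s w w') :
    ∀ (idx : ℕ) (cm : X → Option (ℕ × ℕ)) (cm' : Fin n → Option (ℕ × ℕ))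
      (sw : List (SymAct I)) (ow : List O), AgreeAlong s.2 cm cm' →
      (w.foldlM G.symStep ⟨s.1, idx, cm, sw, ow⟩).map (fun σ => (σ.sw, σ.ow)) =
        (w'.foldlM N.symStep ⟨s, idx, cm', sw, ow⟩).map (fun σ => (σ.sw, σ.ow)) := by
  induction h with
  | nil s => intros; rfl
  | @cons s b a t μ' up w w' hb ht hNδ hr _ ih =>
    intro idx cm cm' sw ow hag
    have hag' := hwf.agreeAlong_cause ht hr idx hag
    cases hb with
    | inp i =>
      simp only [List.foldlM_cons, GMMT.symStep, MMT.symStep, ht, hNδ, Option.bind_some,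
        Option.map_some, Option.bind_eq_bind]
      refine ih _ _ _ _ _ ?_
      rcases up with _ | ⟨y, c⟩ <;> exact hag'
    | timeout x =>
      have hx := hag x
      simp only [List.foldlM_cons, GMMT.symStep, MMT.symStep, ht, hNδ, Option.bind_some,
        Option.bind_eq_bind, hx]
      cases cm x with
      | none => rfl
      | some p =>
        simp only [Option.map_some, Option.bind_some]
        refine ih _ _ _ _ _ ?_
        rcases up with _ | ⟨y, c⟩ <;> exact hag'

theorem WordRen.symRun_eq (hwf : G.WF) (hN : G.IsRenaming N) {w : List (Act I X)}
    {w' : List (Act I (Fin n))} (h : WordRen G N N.q0 w w') :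
    (G.symRun w).map (fun σ => (σ.sw, σ.ow)) = (N.symRun w').map (fun σ => (σ.sw, σ.ow)) := by
  have := h.foldlM_symStep hwf 1 (fun _ => none) (fun _ => none) [] [] (fun _ => rfl)
  rwa [hN.q0] at this

theorem WordRen.symWord_eq (hwf : G.WF) (hN : G.IsRenaming N) {w : List (Act I X)}
    {w' : List (Act I (Fin n))} (h : WordRen G N N.q0 w w') : G.symWord w = N.symWord w' := by
  simpa [GMMT.symWord, MMT.symWord, Function.comp_def] using
    congrArg (Option.map Prod.fst) (h.symRun_eq hwf hN)

theorem WordRen.outWord_eq (hwf : G.WF) (hN : G.IsRenaming N) {w : List (Act I X)}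
    {w' : List (Act I (Fin n))} (h : WordRen G N N.q0 w w') : G.outWord w = N.outWord w' := by
  simpa [GMMT.outWord, MMT.outWord, Function.comp_def] using
    congrArg (Option.map Prod.snd) (h.symRun_eq hwf hN)

theorem IsRenaming.feasible_forward (hwf : G.WF) (hN : G.IsRenaming N) {w : List (Act I X)}
    (h : G.Feasible w) : ∃ w', N.Feasible w' ∧ WordRen G N N.q0 w w' := by
  obtain ⟨ts, C, hrun, rfl⟩ := feasible_iff.1 h
  obtain ⟨ts', D, hrun', hw⟩ := hN.run_forward hwf hrun _ hN.configRen_initC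
  exact ⟨_, MMT.feasible_iff.2 ⟨ts', D, hrun', rfl⟩, hw⟩

theorem IsRenaming.feasible_backward (hwf : G.WF) (hN : G.IsRenaming N)
    {w' : List (Act I (Fin n))} (h : N.Feasible w') :
    ∃ w, G.Feasible w ∧ WordRen G N N.q0 w w' := by
  obtain ⟨ts', D, hrun, rfl⟩ := MMT.feasible_iff.1 h
  obtain ⟨ts, C, hrun', -, hw⟩ := hN.run_backward hwf hrun _ hN.configRen_initC
  exact ⟨_, feasible_iff.2 ⟨ts, C, hrun', rfl⟩, hw⟩

theorem IsRenaming.symEquivM (hwf : G.WF) (hN : G.IsRenaming N) : G.SymEquivM N := by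
  refine ⟨Set.ext fun s => ⟨?_, ?_⟩, fun s os => ⟨?_, ?_⟩⟩
  · rintro ⟨w, hf, hs⟩
    obtain ⟨w', hf', hw⟩ := hN.feasible_forward hwf hf
    exact ⟨w', hf', hw.symWord_eq hwf hN ▸ hs⟩
  · rintro ⟨w', hf', hs⟩
    obtain ⟨w, hf, hw⟩ := hN.feasible_backward hwf hf'
    exact ⟨w, hf, hw.symWord_eq hwf hN ▸ hs⟩
  · rintro ⟨w, hf, hs, ho⟩
    obtain ⟨w', hf', hw⟩ := hN.feasible_forward hwf hf
    exact ⟨w', hf', hw.symWord_eq hwf hN ▸ hs, hw.outWord_eq hwf hN ▸ ho⟩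
  · rintro ⟨w', hf', hs, ho⟩
    obtain ⟨w, hf, hw⟩ := hN.feasible_backward hwf hf'
    exact ⟨w, hf, hw.symWord_eq hwf hN ▸ hs, hw.outWord_eq hwf hN ▸ ho⟩

theorem IsRenaming.complete (hwf : G.WF) (hN : G.IsRenaming N) (hG : G.Complete) :
    N.Complete := by
  have hdef : ∀ s b a, ActRen s.2 b a → (G.δ s.1 b).isSome → (N.δ s a).isSome := by
    intro s b a hb h
    obtain ⟨t, ht⟩ := Option.isSome_iff_exists.1 h
    obtain ⟨μ', up, hNδ, -⟩ := hN.forward s b a t hb ht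
    rw [hNδ]
    rfl
  rintro ⟨q, μ⟩
  refine ⟨fun i => hdef _ _ _ (.inp i) ((hG q).1 i), fun x hx => ?_⟩
  obtain ⟨hmem, κ', ⟨ts', D₀, d, hrun, hdelay⟩, h0⟩ := hx
  rw [hN.chi] at hmem
  obtain ⟨y, rfl⟩ := hmem
  obtain ⟨ts, C₀, hrun', hCD₀, -⟩ := hN.run_backward hwf hrun _ hN.configRen_initC
  obtain ⟨-, ⟨q', κ⟩, hdelay', hst, hag⟩ := hN.delay_backward hCD₀ hdelay
  obtain rfl : q' = q := hst
  exact hdef ⟨q', μ⟩ _ _ (.timeout y)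
    ((hG q').2 y ⟨y.2, κ, ⟨ts, C₀, d, hrun', hdelay'⟩, (hag y).symm.trans h0⟩)

theorem card_named_le [Fintype X] [Fintype Q] (G : GMMT I O X Q) {n : ℕ}
    (hn : ∀ q : Q, (G.chi q).ncard ≤ n) :
    Fintype.card (G.Named n) ≤ n.factorial * Fintype.card Q := by
  rw [Fintype.card_sigma, mul_comm]
  refine (Finset.sum_le_card_nsmul _ _ n.factorial fun q _ => ?_).trans_eq
    (by rw [Finset.card_univ, smul_eq_mul])
  have hcard : Fintype.card (G.chi q) ≤ n := by
    rw [← Nat.card_eq_fintype_card]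
    exact hn q
  rw [Fintype.card_embedding_eq, Fintype.card_fin, ← Nat.factorial_mul_descFactorial hcard]
  exact Nat.le_mul_of_pos_left _ (Nat.factorial_pos _)

end GMMT

open MMT GMMT in
/-- For every well-formed gMMT `G` with at most `n` active timers per state, there is
an MMT symbolically equivalent to `G`, complete whenever `G` is complete, with at
most `n! * |Q|` states. -/
theorem gmmt_to_mmt {I O X Q : Type} [Fintype X] [Fintype Q]
    (G : GMMT I O X Q) (hwf : GMMT.WF G) (n : ℕ)
    (hn : ∀ q : Q, (G.chi q).ncard ≤ n) :
    ∃ (XN QN : Type) (_ : Fintype QN) (N : MMT I O XN QN),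
      GMMT.SymEquivM G N ∧ (G.Complete → N.Complete) ∧
      Fintype.card QN ≤ Nat.factorial n * Fintype.card Q := by
  obtain ⟨N, hN⟩ := hwf.exists_isRenaming hn
  exact ⟨Fin n, G.Named n, inferInstance, N, hN.symEquivM hwf, hN.complete hwf,
    G.card_named_le hn⟩
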